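/- Fix a bias p ∈ (0,1). For each n ≥ 2, let f be a p-biased random Boolean function on n variables. Then the expected canalizing strength tends to 0 as n → ∞: lim_{n→∞} E[c(f)] = 0. -/

import Mathlib

open Finset

/-- The input set `c` (a partial assignment of values to variables) collectively
canalizes the Boolean function `f`: some output value `b` is forced whenever all
variables in the domain of `c` take the prescribed values. -/
def CanalizesOn {n : ℕ} (f : (Fin n → Bool) → Bool) (c : Fin n → Option Bool) : Prop :=
  ∃ b : Bool, ∀ x : Fin n → Bool, (∀ i : Fin n, ∀ a : Bool, c i = some a → x i = a) → f x = b

/-- `canalizingProportion n f k` = P_k(f): the number of canalizing k-sets divided by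
the total number 2^k * C(n,k) of k-sets. A k-set is encoded as a partial assignment
`c : Fin n → Option Bool` which is `some` on exactly `k` coordinates. -/
noncomputable def canalizingProportion (n : ℕ) (f : (Fin n → Bool) → Bool) (k : ℕ) : ℝ :=
  (Nat.card {c : Fin n → Option Bool //
      (Finset.univ.filter fun i => (c i).isSome).card = k ∧ CanalizesOn f c} : ℝ) /
    (2 ^ k * (n.choose k) : ℝ)

/-- The canalizing strength of a Boolean function on `n` variables. -/
noncomputable def canalizingStrength (n : ℕ) (f : (Fin n → Bool) → Bool) : ℝ :=
  (1 / ((n : ℝ) - 1)) *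
    ∑ k ∈ Finset.Icc 1 (n - 1), ((2 ^ k : ℝ) / ((2 ^ k : ℝ) - 1)) * canalizingProportion n f k

/-- The probability weight of the Boolean function `f` under the p-biased product
measure: each output value is independently 1 with probability `p`. -/
noncomputable def biasedWeight (n : ℕ) (p : ℝ) (f : (Fin n → Bool) → Bool) : ℝ :=
  ∏ x : Fin n → Bool, (if f x then p else 1 - p)


lemma card_assign (n k : ℕ) :
    (Finset.univ.filter fun c : Fin n → Option Bool =>
      (Finset.univ.filter fun i => (c i).isSome).card = k).card = 2 ^ k * n.choose k := by
  classical
  have h := Finset.card_eq_sum_card_fiberwise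
    (s := Finset.univ.filter fun c : Fin n → Option Bool =>
      (Finset.univ.filter fun i => (c i).isSome).card = k)
    (t := Finset.powersetCard k (Finset.univ : Finset (Fin n)))
    (f := fun c => Finset.univ.filter fun i => (c i).isSome) (by
      intro c hc
      simpa [Finset.mem_powersetCard] using hc)
  rw [h, Finset.sum_congr rfl (g := fun _ => 2 ^ k)]
  · simp [mul_comm]
  · intro S hS
    have hS' : S.card = k := (Finset.mem_powersetCard.1 hS).2
    have : ((Finset.univ.filter fun c : Fin n → Option Bool =>
      (Finset.univ.filter fun i => (c i).isSome).card = k).filter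
        fun c => (Finset.univ.filter fun i => (c i).isSome) = S)
        = Fintype.piFinset (fun i => if i ∈ S then {some true, some false} else {none}) := by
      ext c
      simp only [Finset.mem_filter, Finset.mem_univ, true_and, Fintype.mem_piFinset]
      constructor
      · rintro ⟨-, rfl⟩ i
        rcases hc : c i with _ | (_ | _) <;> simp [hc]
      · intro hc
        have : (Finset.univ.filter fun i => (c i).isSome) = S := by
          ext i
          have := hc i
          by_cases hi : i ∈ S
          · simp only [hi, if_true, Finset.mem_insert, Finset.mem_singleton] at this
            rcases this with h | h <;> simp [h, hi]
          · simp only [hi, if_false, Finset.mem_singleton] at this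
            simp [this, hi]
        exact ⟨by rw [this, hS'], this⟩
    rw [this, Fintype.card_piFinset]
    rw [Finset.prod_congr rfl (g := fun i => if i ∈ S then 2 else 1)]
    · rw [Finset.prod_ite_mem]
      simp [hS']
    · intro i _
      split_ifs <;> simp

/-- inputs compatible with `c` -/
def compat {n : ℕ} (c : Fin n → Option Bool) : Finset (Fin n → Bool) :=
  Finset.univ.filter fun x => ∀ i : Fin n, ∀ a : Bool, c i = some a → x i = a

lemma card_compat {n k : ℕ} (c : Fin n → Option Bool)
    (hc : (Finset.univ.filter fun i => (c i).isSome).card = k) :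
    n - k ≤ (compat c).card := by
  classical
  have : compat c = Fintype.piFinset (fun i => if (c i).isSome then {(c i).getD true}
      else Finset.univ) := by
    ext x
    simp only [compat, Finset.mem_filter, Finset.mem_univ, true_and, Fintype.mem_piFinset]
    refine forall_congr' fun i => ?_
    rcases c i with _ | a
    · simp
    · simp
  rw [this, Fintype.card_piFinset]
  rw [Finset.prod_congr rfl (g := fun i => if (c i).isSome then 1 else 2)]
  · rw [Finset.prod_ite]
    simp only [Finset.prod_const, one_pow, one_mul]
    have h2 := Finset.card_filter_add_card_filter_not (s := (Finset.univ : Finset (Fin n)))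
      (fun i => (c i).isSome = true)
    rw [hc] at h2
    simp only [Finset.card_univ, Fintype.card_fin] at h2
    have : n - k = (Finset.univ.filter fun i => ¬ (c i).isSome = true).card := by omega
    rw [this]
    exact Nat.lt_two_pow_self.le
  · intro i _
    split_ifs <;> simp

lemma prob_const (n : ℕ) (p : ℝ) (X : Finset (Fin n → Bool)) (b : Bool) :
    ∑ f ∈ Finset.univ.filter (fun f : (Fin n → Bool) → Bool => ∀ x ∈ X, f x = b),
      biasedWeight n p f = (if b then p else 1 - p) ^ X.card := by
  classical
  have : (Finset.univ.filter (fun f : (Fin n → Bool) → Bool => ∀ x ∈ X, f x = b))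
      = Fintype.piFinset (fun x => if x ∈ X then {b} else Finset.univ) := by
    ext f
    simp only [Finset.mem_filter, Finset.mem_univ, true_and, Fintype.mem_piFinset]
    refine forall_congr' fun x => ?_
    split_ifs with h <;> simp [h]
  rw [this]
  unfold biasedWeight
  rw [← Finset.prod_univ_sum (fun x : Fin n → Bool => if x ∈ X then ({b} : Finset Bool) else Finset.univ)
    (fun _ y => if y then p else 1 - p)]
  rw [Finset.prod_congr rfl (g := fun x => if x ∈ X then (if b then p else 1 - p) else 1)]
  · rw [Finset.prod_ite_mem]
    simp
  · intro x _
    by_cases h : x ∈ X <;> simp [h]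

lemma biasedWeight_nonneg (n : ℕ) {p : ℝ} (hp0 : 0 < p) (hp1 : p < 1)
    (f : (Fin n → Bool) → Bool) : 0 ≤ biasedWeight n p f := by
  unfold biasedWeight
  refine Finset.prod_nonneg fun x _ => ?_
  split_ifs <;> linarith

open Classical in
lemma prob_canal (n k : ℕ) {p : ℝ} (hp0 : 0 < p) (hp1 : p < 1) (c : Fin n → Option Bool)
    (hc : (Finset.univ.filter fun i => (c i).isSome).card = k) :
    ∑ f ∈ Finset.univ.filter (fun f : (Fin n → Bool) → Bool => CanalizesOn f c),
      biasedWeight n p f ≤ 2 * (max p (1 - p)) ^ (n - k) := by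
  have hsub : Finset.univ.filter (fun f : (Fin n → Bool) → Bool => CanalizesOn f c) ⊆
      Finset.univ.filter (fun f : (Fin n → Bool) → Bool => ∀ x ∈ compat c, f x = true) ∪
      Finset.univ.filter (fun f : (Fin n → Bool) → Bool => ∀ x ∈ compat c, f x = false) := by
    intro f hf
    simp only [Finset.mem_filter, Finset.mem_univ, true_and, Finset.mem_union, compat] at hf ⊢
    obtain ⟨b, hb⟩ := hf
    cases b
    · exact Or.inr hb
    · exact Or.inl hb
  have key : ∀ b : Bool, (if b then p else 1 - p) ^ (compat c).card
      ≤ (max p (1 - p)) ^ (n - k) := by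
    intro b
    have h1 : (if b then p else 1 - p) ≤ max p (1 - p) := by
      split_ifs <;> simp
    have h0 : 0 ≤ (if b then p else 1 - p) := by split_ifs <;> linarith
    have h2 : max p (1 - p) ≤ 1 := max_le hp1.le (by linarith)
    exact (pow_le_pow_left₀ h0 h1 _).trans
      (pow_le_pow_of_le_one (h0.trans h1) h2 (card_compat c hc))
  have ht := key true
  have hf := key false
  rw [← prob_const n p (compat c)] at ht hf
  have h1 := Finset.sum_le_sum_of_subset_of_nonneg hsub
    (f := biasedWeight n p) (fun f _ _ => biasedWeight_nonneg n hp0 hp1 f)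
  have h2 := Finset.sum_union_inter (f := biasedWeight n p)
    (s₁ := Finset.univ.filter (fun f : (Fin n → Bool) → Bool => ∀ x ∈ compat c, f x = true))
    (s₂ := Finset.univ.filter (fun f : (Fin n → Bool) → Bool => ∀ x ∈ compat c, f x = false))
  have h3 : 0 ≤ ∑ f ∈ Finset.univ.filter (fun f : (Fin n → Bool) → Bool => ∀ x ∈ compat c, f x = true) ∩
      Finset.univ.filter (fun f : (Fin n → Bool) → Bool => ∀ x ∈ compat c, f x = false),
      biasedWeight n p f := Finset.sum_nonneg fun f _ => biasedWeight_nonneg n hp0 hp1 f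
  linarith

lemma expected_prop (n k : ℕ) {p : ℝ} (hp0 : 0 < p) (hp1 : p < 1) (hk : k ≤ n) :
    ∑ f : (Fin n → Bool) → Bool, biasedWeight n p f * canalizingProportion n f k
      ≤ 2 * (max p (1 - p)) ^ (n - k) := by
  classical
  have hpos : (0 : ℝ) < 2 ^ k * (n.choose k) := by
    have := Nat.choose_pos hk
    positivity
  have hcard : ∀ f : (Fin n → Bool) → Bool,
      (Nat.card {c : Fin n → Option Bool //
      (Finset.univ.filter fun i => (c i).isSome).card = k ∧ CanalizesOn f c} : ℝ) =
      ∑ c ∈ Finset.univ.filter (fun c : Fin n → Option Bool =>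
        (Finset.univ.filter fun i => (c i).isSome).card = k), if CanalizesOn f c then 1 else 0 := by
    intro f
    rw [Nat.card_eq_fintype_card, Fintype.card_subtype, Finset.sum_boole, Finset.filter_filter]
  simp only [canalizingProportion, hcard]
  simp only [← mul_div_assoc]
  rw [← Finset.sum_div, div_le_iff₀ hpos]
  simp only [Finset.mul_sum]
  rw [Finset.sum_comm]
  calc _ ≤ ∑ c ∈ Finset.univ.filter (fun c : Fin n → Option Bool =>
        (Finset.univ.filter fun i => (c i).isSome).card = k), 2 * (max p (1 - p)) ^ (n - k) := by
        refine Finset.sum_le_sum fun c hc => ?_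
        have := prob_canal n k hp0 hp1 c (Finset.mem_filter.1 hc).2
        rw [Finset.sum_filter] at this
        simpa using this
    _ = _ := by
        rw [Finset.sum_const, card_assign, nsmul_eq_mul]
        push_cast
        ring

lemma prop_nonneg (n : ℕ) (f : (Fin n → Bool) → Bool) (k : ℕ) :
    0 ≤ canalizingProportion n f k := by
  unfold canalizingProportion; positivity

lemma ratio_bound {k : ℕ} (hk : 1 ≤ k) :
    0 ≤ (2 ^ k : ℝ) / ((2 ^ k : ℝ) - 1) ∧ (2 ^ k : ℝ) / ((2 ^ k : ℝ) - 1) ≤ 2 := by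
  have h : (2 : ℝ) ≤ 2 ^ k := by
    simpa using pow_le_pow_right₀ (one_le_two : (1 : ℝ) ≤ 2) hk
  constructor
  · apply div_nonneg <;> linarith
  · rw [div_le_iff₀ (by linarith)]; linarith

lemma expected_bound (n : ℕ) (hn : 2 ≤ n) {p : ℝ} (hp0 : 0 < p) (hp1 : p < 1) :
    ∑ f : (Fin n → Bool) → Bool, biasedWeight n p f * canalizingStrength n f
      ≤ (1 / ((n : ℝ) - 1)) * (4 * (1 - max p (1 - p))⁻¹) := by
  have hn' : (2 : ℝ) ≤ n := by exact_mod_cast hn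
  set q := max p (1 - p) with hq
  have hq0 : 0 ≤ q := hp0.le.trans (le_max_left _ _)
  have hq1 : q < 1 := max_lt hp1 (by linarith)
  have h1 : ∑ f : (Fin n → Bool) → Bool, biasedWeight n p f * canalizingStrength n f
      = (1 / ((n : ℝ) - 1)) * ∑ k ∈ Finset.Icc 1 (n - 1), ((2 ^ k : ℝ) / ((2 ^ k : ℝ) - 1)) *
        ∑ f : (Fin n → Bool) → Bool, biasedWeight n p f * canalizingProportion n f k := by
    simp only [canalizingStrength, Finset.mul_sum]
    rw [Finset.sum_comm]
    refine Finset.sum_congr rfl fun k _ => Finset.sum_congr rfl fun f _ => ?_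
    ring
  rw [h1]
  refine mul_le_mul_of_nonneg_left ?_ (one_div_nonneg.2 (by linarith))
  calc _ ≤ ∑ k ∈ Finset.Icc 1 (n - 1), 4 * q ^ (n - k) := by
        refine Finset.sum_le_sum fun k hk => ?_
        obtain ⟨hk1, hk2⟩ := Finset.mem_Icc.1 hk
        have := mul_le_mul (ratio_bound hk1).2
          (expected_prop n k hp0 hp1 (by omega)) (Finset.sum_nonneg fun f _ =>
            mul_nonneg (biasedWeight_nonneg n hp0 hp1 f) (prop_nonneg n f k)) (by norm_num)
        linarith
    _ ≤ ∑ k ∈ Finset.range (n + 1), 4 * q ^ (n - k) := by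
        refine Finset.sum_le_sum_of_subset_of_nonneg ?_ fun k _ _ => by positivity
        intro k hk
        have := Finset.mem_Icc.1 hk
        exact Finset.mem_range.2 (by omega)
    _ = 4 * ∑ k ∈ Finset.range (n + 1), q ^ k := by
        rw [← Finset.mul_sum, ← Finset.sum_range_reflect (fun k => q ^ k)]
        simp
    _ ≤ _ := by
        refine mul_le_mul_of_nonneg_left ?_ (by norm_num)
        rw [← tsum_geometric_of_lt_one hq0 hq1]
        exact (summable_geometric_of_lt_one hq0 hq1).sum_le_tsum _ fun i _ => by positivity

open Filter in
theorem expected_canalizingStrength_tendsto_zero (p : ℝ) (hp0 : 0 < p) (hp1 : p < 1) :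
    Tendsto
      (fun n : ℕ =>
        ∑ f : (Fin n → Bool) → Bool, biasedWeight n p f * canalizingStrength n f)
      atTop (nhds 0) := by
  have hlim : Tendsto (fun n : ℕ => (1 / ((n : ℝ) - 1)) * (4 * (1 - max p (1 - p))⁻¹))
      atTop (nhds 0) := by
    have h : Tendsto (fun n : ℕ => (n : ℝ) - 1) atTop atTop :=
      tendsto_atTop_add_const_right _ (-1) tendsto_natCast_atTop_atTop
    have h2 := (h.inv_tendsto_atTop).mul_const (4 * (1 - max p (1 - p))⁻¹)
    simpa [one_div] using h2
  refine tendsto_of_tendsto_of_tendsto_of_le_of_le' tendsto_const_nhds hlim ?_ ?_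
  · filter_upwards [eventually_ge_atTop 2] with n hn
    have hn' : (2 : ℝ) ≤ n := by exact_mod_cast hn
    refine Finset.sum_nonneg fun f _ => mul_nonneg (biasedWeight_nonneg n hp0 hp1 f) ?_
    unfold canalizingStrength
    refine mul_nonneg (one_div_nonneg.2 (by linarith)) (Finset.sum_nonneg fun k hk => ?_)
    exact mul_nonneg (ratio_bound (Finset.mem_Icc.1 hk).1).1 (prop_nonneg n f k)
  · filter_upwards [eventually_ge_atTop 2] with n hn
    exact expected_bound n hn hp0 hp1
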